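/- arXiv:1901.07908 — 2 statements merged into one kernel-verified Lean document; each statement's English description precedes it below -/
import Mathlib

section
/- Let d ≥ 2 be an even integer, let r ≤ d−2 be an integer with gcd(r,d)=1 (so r is odd), and let n be a positive integer with n ≡ −r (mod d) and n ≥ d−r. Then, as rational functions in the two variables a and q over ℚ, ∑_{k=0}^{n−1} [ ∏_{i=1}^{d/2} (a^{d+1−2i} q^r; q^d)_k (a^{2i−d−1} q^r; q^d)_k ] · q^{dk} / [ ∏_{i=1}^{d/2} (a^{d−2i} q^d; q^d)_k (a^{2i−d} q^d; q^d)_k ] ≡ 0 (mod (1 − a q^n)(a − q^n)). (Here the numerator parameters are a^{d−1}q^r, a^{d−3}q^r, …, a q^r and a^{1−d}q^r, a^{3−d}q^r, …, a^{−1}q^r; the denominator parameters are a^{d−2}q^d, a^{d−4}q^d, …, q^d and a^{2−d}q^d, a^{4−d}q^d, …, q^d, with (q^d;q^d)_k occurring twice.) -/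
open Finset

/-- Polynomials in the two variables `a` (index 0) and `q` (index 1) over `ℚ`. -/
abbrev MvP : Type := MvPolynomial (Fin 2) ℚ

/-- The field of rational functions in the two variables `a` and `q` over `ℚ`. -/
abbrev FF : Type := FractionRing MvP

/-- The variable `a`, viewed in the field of rational functions. -/
noncomputable def av : FF := algebraMap MvP FF (MvPolynomial.X 0)

/-- The variable `q`, viewed in the field of rational functions. -/
noncomputable def qv : FF := algebraMap MvP FF (MvPolynomial.X 1)

/-- The q-shifted factorial `(x; q)_k = ∏_{j=0}^{k-1} (1 - x q^j)`. -/
noncomputable def poch (x q : FF) (k : ℕ) : FF :=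
  ∏ j ∈ Finset.range k, (1 - x * q ^ j)

/-- `A ≡ 0 (mod P)`: `A = P · (B / C)` where the denominator `C` is coprime
(has no common non-unit factor) with `P`. -/
def CongrZero (A : FF) (P : MvP) : Prop :=
  ∃ B C : MvP, C ≠ 0 ∧ IsRelPrime C P ∧
    A = algebraMap MvP FF P * (algebraMap MvP FF B / algebraMap MvP FF C)

/-- The q-shifted factorial over an arbitrary field. -/
def qPoch {K : Type*} [Field K] (x q : K) (k : ℕ) : K :=
  ∏ j ∈ Finset.range k, (1 - x * q ^ j)

section QSeries

variable {K : Type*} [Field K]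

lemma qPoch_succ (x q : K) (k : ℕ) : qPoch x q (k + 1) = qPoch x q k * (1 - x * q ^ k) :=
  Finset.prod_range_succ _ _

lemma qPoch_add (x q : K) (k m : ℕ) :
    qPoch x q (k + m) = qPoch x q k * qPoch (x * q ^ k) q m := by
  simp only [qPoch, Finset.prod_range_add, pow_add, mul_assoc]

lemma qPoch_ne_zero {x q : K} (h : ∀ j : ℕ, x * q ^ j ≠ 1) (k : ℕ) : qPoch x q k ≠ 0 :=
  Finset.prod_ne_zero_iff.2 fun j _ => sub_ne_zero.2 (h j).symm

/-- The polynomial in `q ^ k` equal to `(b q^m; q)_k / (b; q)_k`. -/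
noncomputable def ratioPoly (b q : K) (m : ℕ) : Polynomial K :=
  Polynomial.C (qPoch b q m)⁻¹ *
    ∏ j ∈ Finset.range m, (1 - Polynomial.C (b * q ^ j) * Polynomial.X)

lemma natDegree_ratioPoly_le (b q : K) (m : ℕ) : (ratioPoly b q m).natDegree ≤ m := by
  refine (Polynomial.natDegree_C_mul_le _ _).trans
    ((Polynomial.natDegree_prod_le _ _).trans ?_)
  calc _ ≤ ∑ _j ∈ Finset.range m, 1 := Finset.sum_le_sum fun j _ => by
        refine (Polynomial.natDegree_sub_le _ _).trans ?_
        simpa using (Polynomial.natDegree_C_mul_le (b * q ^ j) Polynomial.X).trans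
          Polynomial.natDegree_X_le
    _ = m := by simp

lemma eval_ratioPoly {b q : K} (h : ∀ j : ℕ, b * q ^ j ≠ 1) (m k : ℕ) :
    (ratioPoly b q m).eval (q ^ k) = qPoch (b * q ^ m) q k / qPoch b q k := by
  have h1 : qPoch b q m * qPoch (b * q ^ m) q k = qPoch b q k * qPoch (b * q ^ k) q m := by
    rw [← qPoch_add, ← qPoch_add, add_comm]
  have h2 : (ratioPoly b q m).eval (q ^ k) = (qPoch b q m)⁻¹ * qPoch (b * q ^ k) q m := by
    simp only [ratioPoly, Polynomial.eval_mul, Polynomial.eval_C, Polynomial.eval_prod,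
      Polynomial.eval_sub, Polynomial.eval_one, Polynomial.eval_X, qPoch]
    congr 1
    exact Finset.prod_congr rfl fun j _ => by ring
  rw [h2, eq_div_iff (qPoch_ne_zero h k), inv_mul_eq_div, div_mul_eq_mul_div,
    div_eq_iff (qPoch_ne_zero h m)]
  linear_combination -h1

/-- Functional equation of a terminating `₁φ₀` series. -/
lemma terminating_functional_eq {A q : K} {n : ℕ} (hq : ∀ j : ℕ, q ^ (j + 1) ≠ 1)
    (hA : qPoch A q n = 0) (z : K) :
    (1 - z) * ∑ k ∈ Finset.range n, qPoch A q k / qPoch q q k * z ^ k =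
      (1 - A * z) * ∑ k ∈ Finset.range n, qPoch A q k / qPoch q q k * (z * q) ^ k := by
  have hq' : ∀ j : ℕ, q * q ^ j ≠ 1 := fun j => by rw [← pow_succ']; exact hq j
  have key : ∀ m : ℕ,
      (1 - z) * ∑ k ∈ Finset.range m, qPoch A q k / qPoch q q k * z ^ k -
      (1 - A * z) * ∑ k ∈ Finset.range m, qPoch A q k / qPoch q q k * (z * q) ^ k =
      - (qPoch A q m / qPoch q q m * (1 - q ^ m) * z ^ m) := by
    intro m
    induction m with
    | zero => simp
    | succ m ih =>
      have h1 : (1 - q * q ^ m) ≠ 0 := sub_ne_zero.2 (hq' m).symm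
      have h3 : qPoch A q (m + 1) / qPoch q q (m + 1) * (1 - q ^ (m + 1)) =
          qPoch A q m / qPoch q q m * (1 - A * q ^ m) := by
        rw [qPoch_succ, qPoch_succ, pow_succ', mul_div_mul_comm, mul_assoc, div_mul_cancel₀ _ h1,
          div_mul_eq_mul_div]
      rw [Finset.sum_range_succ, Finset.sum_range_succ, h3]
      linear_combination ih
  have := key n
  rw [hA] at this
  linear_combination this

lemma terminating_sum_pow_eq_zero {A q : K} {n N : ℕ} (hq : ∀ j : ℕ, q ^ (j + 1) ≠ 1)
    (hA : A * q ^ N = 1) (hN : N < n) {l : ℕ} (hl : l < N) :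
    ∑ k ∈ Finset.range n, qPoch A q k / qPoch q q k * (q ^ (l + 1)) ^ k = 0 := by
  have hA0 : qPoch A q n = 0 :=
    Finset.prod_eq_zero (Finset.mem_range.2 hN) (by rw [hA, sub_self])
  have hne : ∀ l < N, 1 - A * q ^ l ≠ 0 := by
    intro l hl h
    obtain ⟨c, rfl⟩ := Nat.exists_eq_add_of_lt hl
    apply hq c
    linear_combination hA + q ^ (c + 1) * h
  induction l with
  | zero =>
    have := terminating_functional_eq hq hA0 1
    rw [sub_self, zero_mul, one_mul] at this
    have h := hne 0 hl
    rw [pow_zero] at h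
    simpa using (mul_eq_zero.1 this.symm).resolve_left h
  | succ l ih =>
    have := terminating_functional_eq hq hA0 (q ^ (l + 1))
    rw [ih (by omega), mul_zero, ← pow_succ] at this
    exact (mul_eq_zero.1 this.symm).resolve_left (hne _ hl)

lemma terminating_sum_eval_eq_zero {A q : K} {n N : ℕ} (hq : ∀ j : ℕ, q ^ (j + 1) ≠ 1)
    (hA : A * q ^ N = 1) (hN : N < n) {p : Polynomial K} (hp : p.natDegree < N) :
    ∑ k ∈ Finset.range n, qPoch A q k / qPoch q q k * q ^ k * p.eval (q ^ k) = 0 := by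
  simp only [Polynomial.eval_eq_sum_range, Finset.mul_sum]
  rw [Finset.sum_comm]
  refine Finset.sum_eq_zero fun l hl => ?_
  rw [← mul_zero (p.coeff l),
    ← terminating_sum_pow_eq_zero hq hA hN (l := l) (by rw [Finset.mem_range] at hl; omega),
    Finset.mul_sum]
  refine Finset.sum_congr rfl fun k _ => ?_
  ring

/-- The truncated basic hypergeometric sum with free parameters `a` and `q`. -/
def truncSum (d n : ℕ) (r : ℤ) (a q : K) : K :=
  ∑ k ∈ Finset.range n,
    (∏ i ∈ Finset.Icc 1 (d / 2),
        qPoch (a ^ ((d : ℤ) + 1 - 2 * (i : ℤ)) * q ^ r) (q ^ d) k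
          * qPoch (a ^ (2 * (i : ℤ) - (d : ℤ) - 1) * q ^ r) (q ^ d) k)
      * q ^ (d * k)
    / (∏ i ∈ Finset.Icc 1 (d / 2),
        qPoch (a ^ ((d : ℤ) - 2 * (i : ℤ)) * q ^ (d : ℤ)) (q ^ d) k
          * qPoch (a ^ (2 * (i : ℤ) - (d : ℤ)) * q ^ (d : ℤ)) (q ^ d) k)

lemma truncSum_inv (d n : ℕ) (r : ℤ) (a q : K) :
    truncSum d n r a⁻¹ q = truncSum d n r a q := by
  unfold truncSum
  have h1 : ∀ i : ℤ, a⁻¹ ^ ((d : ℤ) + 1 - 2 * i) = a ^ (2 * i - (d : ℤ) - 1) := fun i => by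
    rw [inv_zpow']; congr 1; ring
  have h2 : ∀ i : ℤ, a⁻¹ ^ (2 * i - (d : ℤ) - 1) = a ^ ((d : ℤ) + 1 - 2 * i) := fun i => by
    rw [inv_zpow']; congr 1; ring
  have h3 : ∀ i : ℤ, a⁻¹ ^ ((d : ℤ) - 2 * i) = a ^ (2 * i - (d : ℤ)) := fun i => by
    rw [inv_zpow']; congr 1; ring
  have h4 : ∀ i : ℤ, a⁻¹ ^ (2 * i - (d : ℤ)) = a ^ ((d : ℤ) - 2 * i) := fun i => by
    rw [inv_zpow']; congr 1; ring
  refine Finset.sum_congr rfl fun k _ => ?_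
  simp only [h1, h2, h3, h4]
  refine congrArg₂ (· / ·) (congrArg₂ (· * ·) ?_ rfl) ?_
  · exact Finset.prod_congr rfl fun i _ => mul_comm _ _
  · exact Finset.prod_congr rfl fun i _ => mul_comm _ _

lemma mul_add_mul_ne_zero {d n : ℕ} (hcop : Nat.Coprime n d) {e j : ℤ} (hj : 0 < j)
    (he : |e| < d) : e * n + d * j ≠ 0 := by
  intro h
  have h1 : (d : ℤ) ∣ e * n := ⟨-j, by linear_combination h⟩
  have h2 : (d : ℤ) ∣ e := by
    have : IsCoprime (d : ℤ) (n : ℤ) := Nat.isCoprime_iff_coprime.2 hcop.symm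
    exact this.dvd_of_dvd_mul_right h1
  have h3 := Int.eq_zero_of_abs_lt_dvd h2 he
  subst h3
  have hd : (0 : ℤ) < d := by simpa using he
  have := mul_pos hd hj
  omega

lemma zpow_mul_pow_ne_one {t : K} (ht0 : t ≠ 0) (ht : ∀ m : ℤ, m ≠ 0 → t ^ m ≠ 1)
    {d n : ℕ} (hcop : Nat.Coprime n d) {e : ℤ} (he : |e| < d) (j : ℕ) :
    (t ^ n) ^ e * t ^ (d : ℤ) * (t ^ d) ^ j ≠ 1 := by
  have : (t ^ n) ^ e * t ^ (d : ℤ) * (t ^ d) ^ j = t ^ (e * n + d * ((j : ℤ) + 1)) := by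
    rw [← zpow_natCast t n, ← zpow_mul, ← zpow_natCast t d, ← zpow_natCast _ j, ← zpow_mul,
      ← zpow_add₀ ht0, ← zpow_add₀ ht0]
    congr 1
    ring
  rw [this]
  exact ht _ (mul_add_mul_ne_zero hcop (by positivity) he)

theorem truncSum_pow_eq_zero {t : K} (ht0 : t ≠ 0) (ht : ∀ m : ℤ, m ≠ 0 → t ^ m ≠ 1)
    {d n M : ℕ} (hd : 2 ≤ d) (heven : Even d) {r : ℤ} (hcop : Nat.Coprime n d)
    (hnr : (n : ℤ) + r = d * (M + 1)) (hlt : d * M + 2 ≤ n) :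
    truncSum d n r (t ^ n) t = 0 := by
  obtain ⟨g, hd_def⟩ : ∃ g, d = 2 * (g + 1) := by
    obtain ⟨c, rfl⟩ := heven
    exact ⟨c - 1, by omega⟩
  set Q := t ^ d with hQ
  set b : ℤ → K := fun e => (t ^ n) ^ e * t ^ (d : ℤ) with hb
  have hb1 : ∀ e : ℤ, |e| < d → ∀ j : ℕ, b e * Q ^ j ≠ 1 := fun e he j =>
    zpow_mul_pow_ne_one ht0 ht hcop he j
  have hbM : ∀ e : ℤ, b e * Q ^ M = (t ^ n) ^ (e + 1) * t ^ r := by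
    intro e
    simp only [hb, hQ]
    rw [← zpow_natCast t n, ← zpow_mul, ← zpow_natCast t d, ← zpow_natCast _ M, ← zpow_mul,
      ← zpow_mul, ← zpow_add₀ ht0, ← zpow_add₀ ht0, ← zpow_add₀ ht0]
    congr 1
    linear_combination -hnr
  set A : K := (t ^ n) ^ (1 - (d : ℤ)) * t ^ r with hA
  obtain ⟨N, hN⟩ : ∃ N, n = N + (M + 1) := 
    ⟨n - (M + 1), (Nat.sub_add_cancel (by nlinarith)).symm⟩
  have hAN : A * Q ^ N = 1 := by
    simp only [hA, hQ]
    rw [← zpow_natCast t n, ← zpow_mul, ← zpow_natCast t d, ← zpow_natCast _ N, ← zpow_mul,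
      ← zpow_add₀ ht0, ← zpow_add₀ ht0, ← zpow_zero t]
    congr 1
    have : (n : ℤ) = N + (M + 1) := by exact_mod_cast hN
    linear_combination hnr - (d : ℤ) * this
  have hQ1 : ∀ j : ℕ, Q ^ (j + 1) ≠ 1 := by
    intro j
    rw [hQ, ← pow_mul, ← zpow_natCast]
    exact ht _ (by positivity)
  set p : Polynomial K :=
    (∏ i ∈ Finset.range (g + 1), ratioPoly (b (d - 2 * (1 + i : ℕ))) Q M) *
      ∏ i ∈ Finset.range g, ratioPoly (b (2 * (1 + i : ℕ) - d)) Q M with hp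
  have hpdeg : p.natDegree < N := by
    have h1 : p.natDegree ≤ (g + 1) * M + g * M := by
      refine Polynomial.natDegree_mul_le.trans (add_le_add ?_ ?_)
      · refine (Polynomial.natDegree_prod_le _ _).trans ?_
        simpa using Finset.sum_le_card_nsmul (Finset.range (g + 1)) _ M
          fun i _ => natDegree_ratioPoly_le (b (d - 2 * (1 + i : ℕ))) Q M
      · refine (Polynomial.natDegree_prod_le _ _).trans ?_
        simpa using Finset.sum_le_card_nsmul (Finset.range g) _ M
          fun i _ => natDegree_ratioPoly_le (b (2 * (1 + i : ℕ) - d)) Q M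
    have h2 : d * M = (g + 1) * M + g * M + M := by rw [hd_def]; ring
    omega
  rw [← terminating_sum_eval_eq_zero hQ1 hAN (show N < n by omega) hpdeg, truncSum]
  refine Finset.sum_congr rfl fun k _ => ?_
  have hdg : d / 2 + 1 - 1 = g + 1 := by omega
  rw [hp, Polynomial.eval_mul, Polynomial.eval_prod, Polynomial.eval_prod,
    ← Finset.Ico_add_one_right_eq_Icc, Finset.prod_Ico_eq_prod_range,
    Finset.prod_Ico_eq_prod_range, hdg, Finset.prod_mul_distrib, Finset.prod_mul_distrib]
  have e1 : ∏ i ∈ Finset.range (g + 1), (ratioPoly (b (d - 2 * (1 + i : ℕ))) Q M).eval (Q ^ k) =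
      (∏ i ∈ Finset.range (g + 1),
        qPoch ((t ^ n) ^ ((d : ℤ) + 1 - 2 * (1 + i : ℕ)) * t ^ r) Q k) /
      ∏ i ∈ Finset.range (g + 1), qPoch (b (d - 2 * (1 + i : ℕ))) Q k := by
    rw [← Finset.prod_div_distrib]
    refine Finset.prod_congr rfl fun i hi => ?_
    rw [Finset.mem_range] at hi
    rw [eval_ratioPoly (hb1 _ (by rw [abs_lt]; push_cast; constructor <;> omega)), hbM]
    congr 4
    ring
  have e2 : ∏ i ∈ Finset.range g, (ratioPoly (b (2 * (1 + i : ℕ) - d)) Q M).eval (Q ^ k) =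
      (∏ i ∈ Finset.range g,
        qPoch ((t ^ n) ^ (2 * ((1 + (i + 1) : ℕ) : ℤ) - d - 1) * t ^ r) Q k) /
      ∏ i ∈ Finset.range g, qPoch (b (2 * (1 + i : ℕ) - d)) Q k := by
    rw [← Finset.prod_div_distrib]
    refine Finset.prod_congr rfl fun i hi => ?_
    rw [Finset.mem_range] at hi
    rw [eval_ratioPoly (hb1 _ (by rw [abs_lt]; push_cast; constructor <;> omega)), hbM]
    congr 4
    push_cast
    ring
  rw [e1, e2, Finset.prod_range_succ' (fun i =>
      qPoch ((t ^ n) ^ (2 * ((1 + i : ℕ) : ℤ) - d - 1) * t ^ r) Q k),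
    Finset.prod_range_succ (fun i =>
      qPoch ((t ^ n) ^ (2 * ((1 + i : ℕ) : ℤ) - d) * t ^ (d : ℤ)) Q k)]
  have e3 : (t ^ n) ^ (2 * ((1 + 0 : ℕ) : ℤ) - d - 1) * t ^ r = A := by
    rw [hA]; congr 2; push_cast; ring
  have e4 : (t ^ n) ^ (2 * ((1 + g : ℕ) : ℤ) - d) * t ^ (d : ℤ) = Q := by
    have : 2 * ((1 + g : ℕ) : ℤ) - d = 0 := by push_cast; omega
    rw [this, zpow_zero, one_mul, zpow_natCast]
  rw [e3, e4, pow_mul, ← hQ]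
  simp only [div_eq_mul_inv, mul_inv]
  ring

lemma truncSum_denom_ne_zero {t : K} (ht0 : t ≠ 0) (ht : ∀ m : ℤ, m ≠ 0 → t ^ m ≠ 1)
    {d n : ℕ} (hcop : Nat.Coprime n d) {a : K} (ha : a = t ^ n ∨ a = (t ^ n)⁻¹) (k : ℕ) :
    ∏ i ∈ Finset.Icc 1 (d / 2),
        qPoch (a ^ ((d : ℤ) - 2 * (i : ℤ)) * t ^ (d : ℤ)) (t ^ d) k
          * qPoch (a ^ (2 * (i : ℤ) - (d : ℤ)) * t ^ (d : ℤ)) (t ^ d) k ≠ 0 := by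
  refine Finset.prod_ne_zero_iff.2 fun i hi => ?_
  rw [Finset.mem_Icc] at hi
  have key : ∀ e : ℤ, |e| < d → qPoch (a ^ e * t ^ (d : ℤ)) (t ^ d) k ≠ 0 := by
    intro e he
    refine qPoch_ne_zero (fun j => ?_) k
    rcases ha with rfl | rfl
    · exact zpow_mul_pow_ne_one ht0 ht hcop he j
    · rw [inv_zpow']
      exact zpow_mul_pow_ne_one ht0 ht hcop (by rwa [abs_neg]) j
  exact mul_ne_zero (key _ (by rw [abs_lt]; omega)) (key _ (by rw [abs_lt]; omega))

end QSeries

section Specialization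

variable {R F K : Type*} [CommRing R] [Field F] [Algebra R F] [Field K]

/-- `x` can be written as a fraction whose denominator is not killed by `φ`, and `v` is the
resulting value of `x` under `φ`. -/
def SpecializesTo (φ : R →+* K) (x : F) (v : K) : Prop :=
  ∃ S T : R, φ T ≠ 0 ∧ x * algebraMap R F T = algebraMap R F S ∧ v * φ T = φ S

namespace SpecializesTo

variable {φ : R →+* K} {x y : F} {v w : K}

lemma of_algebraMap (φ : R →+* K) (s : R) : SpecializesTo φ (algebraMap R F s) (φ s) :=
  ⟨s, 1, by simp, by simp, by simp⟩

lemma one (φ : R →+* K) : SpecializesTo φ (1 : F) 1 := by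
  simpa using of_algebraMap (F := F) φ 1

lemma zero (φ : R →+* K) : SpecializesTo φ (0 : F) 0 := by
  simpa using of_algebraMap (F := F) φ 0

lemma mul (hx : SpecializesTo φ x v) (hy : SpecializesTo φ y w) :
    SpecializesTo φ (x * y) (v * w) := by
  obtain ⟨S, T, hT, h1, h2⟩ := hx
  obtain ⟨S', T', hT', h1', h2'⟩ := hy
  refine ⟨S * S', T * T', by simp [hT, hT'], ?_, ?_⟩
  · rw [map_mul, map_mul, ← h1, ← h1']; ring
  · rw [map_mul, map_mul, ← h2, ← h2']; ring

lemma add (hx : SpecializesTo φ x v) (hy : SpecializesTo φ y w) :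
    SpecializesTo φ (x + y) (v + w) := by
  obtain ⟨S, T, hT, h1, h2⟩ := hx
  obtain ⟨S', T', hT', h1', h2'⟩ := hy
  refine ⟨S * T' + S' * T, T * T', by simp [hT, hT'], ?_, ?_⟩
  · rw [map_mul, map_add, map_mul, map_mul, ← h1, ← h1']; ring
  · rw [map_mul, map_add, map_mul, map_mul, ← h2, ← h2']; ring

lemma sub (hx : SpecializesTo φ x v) (hy : SpecializesTo φ y w) :
    SpecializesTo φ (x - y) (v - w) := by
  obtain ⟨S, T, hT, h1, h2⟩ := hx
  obtain ⟨S', T', hT', h1', h2'⟩ := hy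
  refine ⟨S * T' - S' * T, T * T', by simp [hT, hT'], ?_, ?_⟩
  · rw [map_mul, map_sub, map_mul, map_mul, ← h1, ← h1']; ring
  · rw [map_mul, map_sub, map_mul, map_mul, ← h2, ← h2']; ring

lemma pow (hx : SpecializesTo φ x v) (k : ℕ) : SpecializesTo φ (x ^ k) (v ^ k) := by
  induction k with
  | zero => simpa using one φ
  | succ k ih => rw [pow_succ, pow_succ]; exact ih.mul hx

lemma prod {ι : Type*} {s : Finset ι} {f : ι → F} {g : ι → K}
    (h : ∀ i, SpecializesTo φ (f i) (g i)) :
    SpecializesTo φ (∏ i ∈ s, f i) (∏ i ∈ s, g i) :=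
  Finset.prod_hom_rel (one φ) fun i _ _ hi => (h i).mul hi

lemma sum {ι : Type*} {s : Finset ι} {f : ι → F} {g : ι → K}
    (h : ∀ i, SpecializesTo φ (f i) (g i)) :
    SpecializesTo φ (∑ i ∈ s, f i) (∑ i ∈ s, g i) :=
  Finset.sum_hom_rel (zero φ) fun i _ _ hi => (h i).add hi

lemma qPoch (hx : SpecializesTo φ x v) (hy : SpecializesTo φ y w) (k : ℕ) :
    SpecializesTo φ (qPoch x y k) (qPoch v w k) :=
  prod fun j => (one φ).sub (hx.mul (hy.pow j))

variable [FaithfulSMul R F]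

lemma inv (hx : SpecializesTo φ x v) (hv : v ≠ 0) : SpecializesTo φ x⁻¹ v⁻¹ := by
  obtain ⟨S, T, hT, h1, h2⟩ := hx
  have hS : φ S ≠ 0 := by rw [← h2]; exact mul_ne_zero hv hT
  have hS' : algebraMap R F S ≠ 0 := by
    intro h
    apply hS
    rw [(FaithfulSMul.algebraMap_eq_zero_iff R F).1 h, map_zero]
  have hx0 : x ≠ 0 := by
    rintro rfl
    exact hS' (by rw [← h1, zero_mul])
  refine ⟨T, S, hS, ?_, ?_⟩
  · rw [← h1, inv_mul_cancel_left₀ hx0]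
  · rw [← h2, inv_mul_cancel_left₀ hv]

lemma div (hx : SpecializesTo φ x v) (hy : SpecializesTo φ y w) (hw : w ≠ 0) :
    SpecializesTo φ (x / y) (v / w) := by
  rw [div_eq_mul_inv, div_eq_mul_inv]
  exact hx.mul (hy.inv hw)

lemma zpow (hx : SpecializesTo φ x v) (hv : v ≠ 0) (m : ℤ) :
    SpecializesTo φ (x ^ m) (v ^ m) := by
  cases m with
  | ofNat k => simpa using hx.pow k
  | negSucc k =>
    rw [zpow_negSucc, zpow_negSucc]
    exact (hx.pow _).inv (pow_ne_zero _ hv)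

lemma truncSum (hx : SpecializesTo φ x v) (hy : SpecializesTo φ y w) (hv : v ≠ 0)
    (hw : w ≠ 0) {d n : ℕ} {r : ℤ}
    (hden : ∀ k, ∏ i ∈ Finset.Icc 1 (d / 2),
      _root_.qPoch (v ^ ((d : ℤ) - 2 * (i : ℤ)) * w ^ (d : ℤ)) (w ^ d) k
        * _root_.qPoch (v ^ (2 * (i : ℤ) - (d : ℤ)) * w ^ (d : ℤ)) (w ^ d) k ≠ 0) :
    SpecializesTo φ (truncSum d n r x y) (truncSum d n r v w) := by
  have key : ∀ (e f : ℤ) (k : ℕ), SpecializesTo φ (_root_.qPoch (x ^ e * y ^ f) (y ^ d) k)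
      (_root_.qPoch (v ^ e * w ^ f) (w ^ d) k) := fun e f k =>
    ((hx.zpow hv e).mul (hy.zpow hw f)).qPoch (hy.pow d) k
  exact sum fun k => ((prod fun i => (key _ _ k).mul (key _ _ k)).mul (hy.pow _)).div
    (prod fun i => (key _ _ k).mul (key _ _ k)) (hden k)

end SpecializesTo

end Specialization

/-- A nonzero element generating the kernel of a ring homomorphism to a domain is prime. -/
lemma prime_of_map_eq_zero_iff_dvd {R L : Type*} [CommRing R] [CommRing L] [IsDomain L]
    {φ : R →+* L} {P : R} (hP : P ≠ 0) (h : ∀ f, φ f = 0 ↔ P ∣ f) : Prime P := by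
  refine ⟨hP, fun hu => ?_, fun f g hfg => ?_⟩
  · have := (h 1).2 hu.dvd
    simp at this
  · rw [← h, map_mul, mul_eq_zero] at hfg
    rwa [h, h] at hfg

lemma map_eq_zero_iff_dvd_of_retract {R L : Type*} [CommRing R] [CommRing L]
    {P : R} (φ : R →+* L) (ψ : L →+* R ⧸ Ideal.span {P}) (hφ : φ P = 0)
    (h : ∀ f, ψ (φ f) = Ideal.Quotient.mk _ f) (f : R) : φ f = 0 ↔ P ∣ f := by
  constructor
  · intro hf
    rw [← Ideal.mem_span_singleton, ← Ideal.Quotient.eq_zero_iff_mem, ← h, hf, map_zero]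
  · rintro ⟨g, rfl⟩
    rw [map_mul, hφ, zero_mul]

section TwoPrimes

open MvPolynomial

/-- The specialization `a = q ^ n`. -/
noncomputable def specPos (n : ℕ) : MvP →ₐ[ℚ] Polynomial ℚ :=
  aeval ![Polynomial.X ^ n, Polynomial.X]

/-- The specialization `a = q ^ (-n)`. -/
noncomputable def specNeg (n : ℕ) : MvP →ₐ[ℚ] LaurentPolynomial ℚ :=
  aeval ![LaurentPolynomial.T (-n), LaurentPolynomial.T 1]

lemma specPos_X_zero (n : ℕ) : specPos n (X 0) = Polynomial.X ^ n := aeval_X _ _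

lemma specPos_X_one (n : ℕ) : specPos n (X 1) = Polynomial.X := aeval_X _ _

lemma specNeg_X_zero (n : ℕ) : specNeg n (X 0) = LaurentPolynomial.T (-n) := aeval_X _ _

lemma specNeg_X_one (n : ℕ) : specNeg n (X 1) = LaurentPolynomial.T 1 := aeval_X _ _

lemma specNeg_X_zero_mul (n : ℕ) : specNeg n (X 0) * specNeg n (X 1) ^ n = 1 := by
  rw [specNeg_X_zero, specNeg_X_one, LaurentPolynomial.T_pow, ← LaurentPolynomial.T_add,
    mul_one, neg_add_cancel, LaurentPolynomial.T_zero]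

lemma specPos_eq_zero_iff (n : ℕ) (f : MvP) :
    specPos n f = 0 ↔ (X 0 - X 1 ^ n : MvP) ∣ f := by
  set P : MvP := X 0 - X 1 ^ n with hP
  let ψ : Polynomial ℚ →ₐ[ℚ] MvP ⧸ Ideal.span {P} :=
    Polynomial.aeval (Ideal.Quotient.mk _ (X 1))
  have hmk : (Ideal.Quotient.mk (Ideal.span {P})) (X 0) =
      (Ideal.Quotient.mk (Ideal.span {P})) (X 1) ^ n := by
    rw [← map_pow, Ideal.Quotient.eq, ← hP]
    exact Ideal.mem_span_singleton_self P
  have hcomp : ψ.comp (specPos n) = Ideal.Quotient.mkₐ ℚ (Ideal.span {P}) := by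
    refine MvPolynomial.algHom_ext fun i => ?_
    fin_cases i
    · simp [ψ, specPos, hmk]
    · simp [ψ, specPos]
  refine map_eq_zero_iff_dvd_of_retract (specPos n).toRingHom ψ.toRingHom ?_
    (fun f => DFunLike.congr_fun hcomp f) f
  change specPos n P = 0
  rw [hP, map_sub, map_pow, specPos_X_zero, specPos_X_one, sub_self]

lemma specNeg_eq_zero_iff {n : ℕ} (hn : 0 < n) (f : MvP) :
    specNeg n f = 0 ↔ (1 - X 0 * X 1 ^ n : MvP) ∣ f := by
  set P : MvP := 1 - X 0 * X 1 ^ n with hP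
  have hmk : (Ideal.Quotient.mk (Ideal.span {P})) (X 0) *
      (Ideal.Quotient.mk (Ideal.span {P})) (X 1) ^ n = 1 := by
    rw [← map_pow, ← map_mul, eq_comm, ← map_one (Ideal.Quotient.mk (Ideal.span {P})),
      Ideal.Quotient.eq, ← hP]
    exact Ideal.mem_span_singleton_self P
  obtain ⟨u, hu⟩ : IsUnit (Ideal.Quotient.mk (Ideal.span {P}) (X 1)) := by
    have := IsUnit.of_mul_eq_one_right _ hmk
    exact (isUnit_pow_iff hn.ne').1 this
  let ψ : LaurentPolynomial ℚ →+* MvP ⧸ Ideal.span {P} :=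
    LaurentPolynomial.eval₂ (algebraMap ℚ _) u
  have hcomp : ∀ f, ψ (specNeg n f) = Ideal.Quotient.mk (Ideal.span {P}) f := by
    have : ψ.comp (specNeg n).toRingHom = Ideal.Quotient.mk (Ideal.span {P}) := by
      refine MvPolynomial.ringHom_ext (fun c => ?_) fun i => ?_
      · simp [ψ, specNeg]
        rfl
      · fin_cases i
        · change ψ (specNeg n (X 0)) = _
          rw [specNeg_X_zero, LaurentPolynomial.eval₂_T_neg_n]
          rw [← hu] at hmk
          have h1 : (↑u⁻¹ : MvP ⧸ Ideal.span {P}) ^ n * (u : MvP ⧸ Ideal.span {P}) ^ n = 1 := by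
            rw [← mul_pow, Units.inv_mul, one_pow]
          exact (u.isUnit.pow n).mul_right_cancel (h1.trans hmk.symm)
        · simp [ψ, specNeg, hu]
    exact fun f => DFunLike.congr_fun this f
  refine map_eq_zero_iff_dvd_of_retract (specNeg n).toRingHom ψ ?_ hcomp f
  change specNeg n P = 0
  rw [hP, map_sub, map_one, map_mul, map_pow, specNeg_X_zero_mul, sub_self]

end TwoPrimes

/-- Membership in the kernel of a specialization can be read off from reduced fractions. -/
lemma dvd_num_and_not_dvd_den {R F K : Type*} [CommRing R] [IsDomain R]
    [UniqueFactorizationMonoid R] [Field F] [Algebra R F] [IsFractionRing R F] [Field K]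
    {φ : R →+* K} {P : R} (hP : Prime P) (h : ∀ f, φ f = 0 ↔ P ∣ f) {x : F}
    (hx : SpecializesTo φ x 0) :
    P ∣ IsFractionRing.num R x ∧ ¬ P ∣ (IsFractionRing.den R x : R) := by
  obtain ⟨S, T, hT, h1, h2⟩ := hx
  have hrel := IsFractionRing.num_den_reduced R x
  have hS : P ∣ S := by rw [← h, ← h2, zero_mul]
  have heq : S * IsFractionRing.den R x = IsFractionRing.num R x * T := by
    apply IsFractionRing.injective R F
    rw [map_mul, map_mul, ← h1]
    have : x * algebraMap R F (IsFractionRing.den R x) =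
        algebraMap R F (IsFractionRing.num R x) := by
      have h := IsLocalization.mk'_spec F (IsFractionRing.num R x) (IsFractionRing.den R x)
      rwa [IsFractionRing.mk'_num_den] at h
    rw [← this]
    ring
  have hnum : P ∣ IsFractionRing.num R x :=
    (hP.dvd_or_dvd (heq ▸ hS.mul_right _)).resolve_right fun hd => hT ((h T).2 hd)
  exact ⟨hnum, fun hd => hP.not_isUnit (hrel hnum hd)⟩


theorem stmt9 (d : ℕ) (hd : 2 ≤ d) (heven : Even d) (r : ℤ) (hr : r ≤ (d : ℤ) - 2)
    (hgcd : Int.gcd r d = 1) (n : ℕ) (hn : 0 < n)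
    (hmod : (n : ℤ) ≡ -r [ZMOD (d : ℤ)]) (hge : (d : ℤ) - r ≤ (n : ℤ)) :
    CongrZero
      (∑ k ∈ Finset.range n,
        (∏ i ∈ Finset.Icc 1 (d / 2),
            poch (av ^ ((d : ℤ) + 1 - 2 * (i : ℤ)) * qv ^ r) (qv ^ d) k
              * poch (av ^ (2 * (i : ℤ) - (d : ℤ) - 1) * qv ^ r) (qv ^ d) k)
          * qv ^ (d * k)
        / (∏ i ∈ Finset.Icc 1 (d / 2),
            poch (av ^ ((d : ℤ) - 2 * (i : ℤ)) * qv ^ (d : ℤ)) (qv ^ d) k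
              * poch (av ^ (2 * (i : ℤ) - (d : ℤ)) * qv ^ (d : ℤ)) (qv ^ d) k))
      ((1 - MvPolynomial.X 0 * MvPolynomial.X 1 ^ n)
        * (MvPolynomial.X 0 - MvPolynomial.X 1 ^ n)) := by
  change CongrZero (truncSum d n r av qv) _
  obtain ⟨c, hc⟩ : (d : ℤ) ∣ n + r := by
    have := hmod.symm.dvd
    rwa [sub_neg_eq_add] at this
  have hd0 : (0 : ℤ) < d := by omega
  obtain ⟨M, hnr⟩ : ∃ M : ℕ, (n : ℤ) + r = d * (M + 1) := by
    have : 1 ≤ c := by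
      by_contra! h
      nlinarith
    exact ⟨(c - 1).toNat, by rw [hc, Int.toNat_of_nonneg (by omega)]; ring⟩
  have hlt : d * M + 2 ≤ n := by
    zify
    linarith
  have hcop : Nat.Coprime n d := by
    rw [← Nat.isCoprime_iff_coprime]
    have h1 : IsCoprime (-r + d * c) (d : ℤ) :=
      IsCoprime.add_mul_left_left (IsCoprime.neg_left (Int.isCoprime_iff_gcd_eq_one.2 hgcd)) c
    have h2 : (n : ℤ) = -r + d * c := by linear_combination hc
    rwa [h2]
  set P : MvP := 1 - MvPolynomial.X 0 * MvPolynomial.X 1 ^ n with hP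
  set P' : MvP := MvPolynomial.X 0 - MvPolynomial.X 1 ^ n with hP'
  have key : ∀ {L : Type} [CommRing L] [IsDomain L] (φ : MvP →+* L) (R : MvP),
      R ≠ 0 → (∀ f, φ f = 0 ↔ R ∣ f) → φ (MvPolynomial.X 1) ≠ 0 →
      (∀ m : ℕ, 0 < m → φ (MvPolynomial.X 1) ^ m ≠ 1) →
      (φ (MvPolynomial.X 0) = φ (MvPolynomial.X 1) ^ n ∨
        φ (MvPolynomial.X 0) * φ (MvPolynomial.X 1) ^ n = 1) →
      Prime R ∧ R ∣ IsFractionRing.num MvP (truncSum d n r av qv) ∧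
        ¬ R ∣ (IsFractionRing.den MvP (truncSum d n r av qv) : MvP) := by
    intro L _ _ φ R hR hφ h0 h1 ha
    have hprime := prime_of_map_eq_zero_iff_dvd hR hφ
    refine ⟨hprime, ?_⟩
    let φ' : MvP →+* FractionRing L := (algebraMap L (FractionRing L)).comp φ
    have hinj := IsFractionRing.injective L (FractionRing L)
    have hφ' : ∀ f, φ' f = 0 ↔ R ∣ f := fun f => by
      rw [← hφ, RingHom.comp_apply, map_eq_zero_iff _ hinj]
    set t := φ' (MvPolynomial.X 1) with ht
    have ht0 : t ≠ 0 := by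
      rw [ht, RingHom.comp_apply, Ne, map_eq_zero_iff _ hinj]
      exact h0
    have htpow : ∀ m : ℕ, 0 < m → t ^ m ≠ 1 := fun m hm h =>
      h1 m hm (hinj (by simpa [ht, φ'] using h))
    have htz : ∀ m : ℤ, m ≠ 0 → t ^ m ≠ 1 := by
      intro m hm h
      rcases Int.natAbs_eq m with h2 | h2
      · rw [h2, zpow_natCast] at h
        exact htpow _ (Int.natAbs_pos.2 hm) h
      · rw [h2, zpow_neg, zpow_natCast, inv_eq_one] at h
        exact htpow _ (Int.natAbs_pos.2 hm) h
    have ha' : φ' (MvPolynomial.X 0) = t ^ n ∨ φ' (MvPolynomial.X 0) = (t ^ n)⁻¹ := by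
      refine ha.imp (fun h => ?_) fun h => ?_
      · simp [ht, φ', h]
      · refine eq_inv_of_mul_eq_one_left ?_
        rw [ht, RingHom.comp_apply, RingHom.comp_apply, ← map_pow, ← map_mul, h, map_one]
    have hval : truncSum d n r (φ' (MvPolynomial.X 0)) t = 0 := by
      rcases ha' with h | h <;> rw [h]
      · exact truncSum_pow_eq_zero ht0 htz hd heven hcop hnr hlt
      · rw [truncSum_inv]
        exact truncSum_pow_eq_zero ht0 htz hd heven hcop hnr hlt
    have hv : φ' (MvPolynomial.X 0) ≠ 0 := by
      rcases ha' with h | h <;> rw [h]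
      · exact pow_ne_zero _ ht0
      · exact inv_ne_zero (pow_ne_zero _ ht0)
    refine dvd_num_and_not_dvd_den hprime hφ' ?_
    rw [← hval]
    exact (SpecializesTo.of_algebraMap φ' _).truncSum (SpecializesTo.of_algebraMap φ' _) hv ht0
      (truncSum_denom_ne_zero ht0 htz hcop ha')
  have hP0 : P ≠ 0 := by
    intro h
    simpa [hP, hn.ne'] using congrArg (MvPolynomial.eval 0) h
  have hPpos0 : P' ≠ 0 := by
    intro h
    simpa [hP', hn.ne'] using congrArg (MvPolynomial.eval ![1, 0]) h
  have hT : ∀ m : ℕ, 0 < m → (LaurentPolynomial.T 1 : LaurentPolynomial ℚ) ^ m ≠ 1 := by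
    intro m hm h
    rw [LaurentPolynomial.T_pow, ← LaurentPolynomial.T_zero] at h
    have := congrArg LaurentPolynomial.degree h
    rw [LaurentPolynomial.degree_T, LaurentPolynomial.degree_T, WithBot.coe_inj] at this
    omega
  have hX : ∀ m : ℕ, 0 < m → (Polynomial.X : Polynomial ℚ) ^ m ≠ 1 := by
    intro m hm h
    have := congrArg Polynomial.natDegree h
    simp at this
    omega
  obtain ⟨hp, hpn, hpd⟩ := key (specNeg n).toRingHom P hP0 (specNeg_eq_zero_iff hn)
    (by
      change specNeg n _ ≠ 0
      rw [specNeg_X_one]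
      exact (LaurentPolynomial.isUnit_T 1).ne_zero)
    (by
      change ∀ m : ℕ, 0 < m → specNeg n _ ^ m ≠ 1
      rwa [specNeg_X_one])
    (Or.inr (specNeg_X_zero_mul n))
  obtain ⟨hp', hpn', hpd'⟩ := key (specPos n).toRingHom P' hPpos0 (specPos_eq_zero_iff n)
    (by
      change specPos n _ ≠ 0
      rw [specPos_X_one]
      exact Polynomial.X_ne_zero)
    (by
      change ∀ m : ℕ, 0 < m → specPos n _ ^ m ≠ 1
      rwa [specPos_X_one])
    (Or.inl ((specPos_X_zero n).trans (by rw [← specPos_X_one n]; rfl)))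
  have hndvd : ¬ P' ∣ P := by
    rw [← specPos_eq_zero_iff n, hP, map_sub, map_one, map_mul, map_pow, specPos_X_zero,
      specPos_X_one, ← pow_add, sub_eq_zero]
    exact (hX (n + n) (by omega)).symm
  obtain ⟨C, hC⟩ := hpn
  obtain ⟨B, hB⟩ : P' ∣ C := (hp'.dvd_or_dvd (hC ▸ hpn')).resolve_left hndvd
  refine ⟨B, (IsFractionRing.den MvP (truncSum d n r av qv) : MvP),
    nonZeroDivisors.ne_zero (IsFractionRing.den MvP (truncSum d n r av qv)).2, ?_, ?_⟩
  · exact IsRelPrime.mul_right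
      ((hp.irreducible.isRelPrime_iff_not_dvd.2 hpd).symm)
      ((hp'.irreducible.isRelPrime_iff_not_dvd.2 hpd').symm)
  · conv_lhs => rw [← IsFractionRing.mk'_num_den MvP (truncSum d n r av qv)]
    rw [IsFractionRing.mk'_eq_div, hC, hB, ← mul_div_assoc, ← map_mul, mul_assoc]
end

section
/- Let r ∈ {1, 2, 4} and let n be a positive integer with n ≡ −r (mod 9). Then, as rational functions in the two variables a and q over ℚ, ∑_{k=0}^{n−1} (a^8 q^r; q^9)_k (q^r/a^8; q^9)_k (q^{9−2r}; q^9)_k · q^{9k} / ( (a^7 q^9; q^9)_k (q^9/a^7; q^9)_k (q^9; q^9)_k ) ≡ 0 (mod (1 − a q^n)(a − q^n)). -/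
open Finset

/-! ### Shifted factorials -/

lemma poch_zero (x p : FF) : poch x p 0 = 1 := by simp [poch]

lemma poch_succ (x p : FF) (k : ℕ) : poch x p (k + 1) = poch x p k * (1 - x * p ^ k) := by
  simp [poch, Finset.prod_range_succ]

lemma poch_add (x p : FF) (k j : ℕ) :
    poch x p (k + j) = poch x p k * poch (x * p ^ k) p j := by
  simp only [poch, Finset.prod_range_add, pow_add, mul_assoc]

lemma poch_succ' (x p : FF) (k : ℕ) : poch x p (k + 1) = (1 - x) * poch (x * p) p k := by
  rw [add_comm, poch_add]; simp [poch]

lemma poch_ne_zero {x p : FF} (h : ∀ i : ℕ, x * p ^ i ≠ 1) (k : ℕ) : poch x p k ≠ 0 :=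
  Finset.prod_ne_zero_iff.2 fun i _ => sub_ne_zero.2 (h i).symm

lemma poch_self_ne_zero {p : FF} (h : ∀ i : ℕ, 0 < i → p ^ i ≠ 1) (k : ℕ) : poch p p k ≠ 0 :=
  poch_ne_zero (fun i => by rw [← pow_succ']; exact h _ i.succ_pos) k

/-- The terminating `q`-binomial theorem. -/
lemma sum_poch_inv_pow {p : FF} (hp : p ≠ 0) (h : ∀ i : ℕ, 0 < i → p ^ i ≠ 1) (z : FF) (N : ℕ) :
    ∀ M, N < M → ∑ k ∈ Finset.range M, poch ((p ^ N)⁻¹) p k / poch p p k * z ^ k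
      = poch (z * (p ^ N)⁻¹) p N := by
  induction N with
  | zero =>
    intro M hM
    rw [Finset.sum_eq_single_of_mem 0 (Finset.mem_range.2 hM)]
    · simp [poch]
    · rintro (_ | k) _ hk
      · exact absurd rfl hk
      · rw [poch_succ']; simp
  | succ N ih =>
    intro M hM
    obtain ⟨M, rfl⟩ : ∃ M', M = M' + 1 := ⟨M - 1, by omega⟩
    have hv : (p ^ (N + 1))⁻¹ * p = (p ^ N)⁻¹ := by
      rw [pow_succ]; field_simp
    have step : ∀ k, poch ((p ^ (N + 1))⁻¹) p (k + 1) / poch p p (k + 1)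
        = poch ((p ^ N)⁻¹) p (k + 1) / poch p p (k + 1)
          - (p ^ (N + 1))⁻¹ * (poch ((p ^ N)⁻¹) p k / poch p p k) := by
      intro k
      have h1 := poch_self_ne_zero h k
      have h2 : 1 - p * p ^ k ≠ 0 :=
        sub_ne_zero.2 (by rw [← pow_succ']; exact (h _ k.succ_pos).symm)
      rw [poch_succ', hv, poch_succ, poch_succ, ← hv]
      field_simp
      ring
    have e1 := ih (M + 1) (by omega)
    have e2 := ih M (by omega)
    rw [Finset.sum_range_succ'] at e1 ⊢
    have e3 : z * (p ^ (N + 1))⁻¹ * p = z * (p ^ N)⁻¹ := by rw [mul_assoc, hv]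
    rw [poch_succ' _ _ N, e3, sub_mul, one_mul]
    nth_rewrite 1 [← e1]
    rw [← e2]
    simp only [step, poch_zero, Finset.mul_sum, sub_mul, Finset.sum_sub_distrib]
    have : ∀ k, (p ^ (N + 1))⁻¹ * (poch (p ^ N)⁻¹ p k / poch p p k) * z ^ (k + 1)
        = z * (p ^ (N + 1))⁻¹ * (poch (p ^ N)⁻¹ p k / poch p p k * z ^ k) := fun k => by ring
    simp only [this]
    ring

/-- The `q`-analogue of the vanishing of `N`-th differences of polynomials of degree `< N`. -/
lemma sum_poch_inv_pow_mul_eval {p : FF} (hp : p ≠ 0) (h : ∀ i : ℕ, 0 < i → p ^ i ≠ 1)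
    {N M : ℕ} (hM : N < M) (P : Polynomial FF) (hP : P.natDegree < N) :
    ∑ k ∈ Finset.range M, poch ((p ^ N)⁻¹) p k / poch p p k * p ^ k * P.eval (p ^ k) = 0 := by
  simp only [Polynomial.eval_eq_sum_range, Finset.mul_sum]
  rw [Finset.sum_comm]
  refine Finset.sum_eq_zero fun j hj => ?_
  have hj' : j < N := by have := Finset.mem_range.1 hj; omega
  have e := sum_poch_inv_pow hp h (p ^ (j + 1)) N M hM
  have hz : poch (p ^ (j + 1) * (p ^ N)⁻¹) p N = 0 := by
    refine Finset.prod_eq_zero (Finset.mem_range.2 (show N - 1 - j < N by omega)) ?_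
    have : p ^ (j + 1) * (p ^ N)⁻¹ * p ^ (N - 1 - j) = 1 := by
      rw [mul_right_comm, ← pow_add, show j + 1 + (N - 1 - j) = N by omega,
        mul_inv_cancel₀ (pow_ne_zero _ hp)]
    rw [this, sub_self]
  rw [hz] at e
  rw [← mul_zero (P.coeff j), ← e, Finset.mul_sum]
  exact Finset.sum_congr rfl fun k _ => by ring

open Polynomial in
/-- `(D y; p)_m` as a polynomial in `y`. -/
lemma exists_poly_poch (D p : FF) (m : ℕ) :
    ∃ P : Polynomial FF, P.natDegree ≤ m ∧ ∀ y, P.eval y = poch (D * y) p m := by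
  refine ⟨∏ j ∈ Finset.range m, (1 - C (D * p ^ j) * X), ?_, fun y => ?_⟩
  · refine (natDegree_prod_le _ _).trans ?_
    refine (Finset.sum_le_card_nsmul _ _ 1 fun j _ => ?_).trans (by simp)
    compute_degree
  · simp only [eval_prod, poch]
    refine Finset.prod_congr rfl fun j _ => ?_
    simp
    ring

lemma poch_shift_div {D p : FF} (hD : ∀ i : ℕ, D * p ^ i ≠ 1) (m k : ℕ) :
    poch (D * p ^ m) p k / poch D p k = poch (D * p ^ k) p m / poch D p m := by
  rw [div_eq_div_iff (poch_ne_zero hD k) (poch_ne_zero hD m), mul_comm, ← poch_add, add_comm,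
    poch_add, mul_comm]

/-- A vanishing case of the `q`-Pfaff–Saalschütz sum. -/
lemma saalschutz_eq_zero {p D E : FF} (hp : p ≠ 0) (h : ∀ i : ℕ, 0 < i → p ^ i ≠ 1)
    (hD : ∀ i : ℕ, D * p ^ i ≠ 1) (hE : ∀ i : ℕ, E * p ^ i ≠ 1) {m l M : ℕ} (hM : m + l + 1 < M) :
    ∑ k ∈ Finset.range M, poch (D * p ^ m) p k * poch ((p ^ (m + l + 1))⁻¹) p k
      * poch (E * p ^ l) p k * p ^ k / (poch D p k * poch E p k * poch p p k) = 0 := by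
  obtain ⟨P, hP, eP⟩ := exists_poly_poch D p m
  obtain ⟨Q, hQ, eQ⟩ := exists_poly_poch E p l
  have e := sum_poch_inv_pow_mul_eval hp h hM (P * Q)
    (by have := Polynomial.natDegree_mul_le (p := P) (q := Q); omega)
  rw [← mul_zero ((poch D p m * poch E p l)⁻¹), ← e, Finset.mul_sum]
  refine Finset.sum_congr rfl fun k _ => ?_
  rw [Polynomial.eval_mul, eP, eQ]
  calc _ = (poch (D * p ^ m) p k / poch D p k) * (poch (E * p ^ l) p k / poch E p k)
        * (poch ((p ^ (m + l + 1))⁻¹) p k / poch p p k * p ^ k) := by ring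
    _ = _ := by rw [poch_shift_div hD, poch_shift_div hE]; ring

/-! ### The variable `q` -/

lemma qv_ne_zero : qv ≠ 0 := by
  simp [qv, MvPolynomial.X_ne_zero]

lemma qv_pow_ne_one {i : ℕ} (hi : 0 < i) : qv ^ i ≠ 1 := by
  intro h
  rw [qv, ← map_pow, ← map_one (algebraMap MvP FF)] at h
  have := congrArg (MvPolynomial.eval (0 : Fin 2 → ℚ)) (IsFractionRing.injective MvP FF h)
  simp [hi.ne'] at this

lemma qv_zpow_ne_one {i : ℤ} (hi : i ≠ 0) : qv ^ i ≠ 1 := by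
  intro h
  rcases lt_or_gt_of_ne hi with hi | hi
  · refine qv_pow_ne_one (i := (-i).toNat) (by omega) ?_
    rw [← zpow_natCast, Int.toNat_of_nonneg (by omega), zpow_neg, h, inv_one]
  · refine qv_pow_ne_one (i := i.toNat) (by omega) ?_
    rw [← zpow_natCast, Int.toNat_of_nonneg (by omega), h]

/-- The sum in question, with an arbitrary value `c` in place of the variable `a`. -/
noncomputable def specSum (r n : ℕ) (c : FF) : FF :=
  ∑ k ∈ Finset.range n,
    poch (c ^ 8 * qv ^ r) (qv ^ 9) k * poch (qv ^ r * c ^ (-8 : ℤ)) (qv ^ 9) k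
        * poch (qv ^ (9 - 2 * r)) (qv ^ 9) k * qv ^ (9 * k)
      / (poch (c ^ 7 * qv ^ 9) (qv ^ 9) k * poch (qv ^ 9 * c ^ (-7 : ℤ)) (qv ^ 9) k
          * poch (qv ^ 9) (qv ^ 9) k)

lemma specSum_inv (r n : ℕ) (c : FF) : specSum r n c⁻¹ = specSum r n c := by
  refine Finset.sum_congr rfl fun k _ => ?_
  have h8 : (c⁻¹) ^ (-8 : ℤ) = c ^ 8 := by rw [zpow_neg, inv_zpow, inv_inv]; rfl
  have h7 : (c⁻¹) ^ (-7 : ℤ) = c ^ 7 := by rw [zpow_neg, inv_zpow, inv_inv]; rfl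
  have h8' : c ^ (-8 : ℤ) = c⁻¹ ^ 8 := by rw [zpow_neg, inv_pow]; rfl
  have h7' : c ^ (-7 : ℤ) = c⁻¹ ^ 7 := by rw [zpow_neg, inv_pow]; rfl
  rw [h8, h7, h8', h7', mul_comm (qv ^ r) (c ^ 8), mul_comm (qv ^ r) (c⁻¹ ^ 8),
    mul_comm (qv ^ 9) (c ^ 7), mul_comm (qv ^ 9) (c⁻¹ ^ 7)]
  ring

lemma qv_nine_ne_zero : qv ^ 9 ≠ 0 := pow_ne_zero _ qv_ne_zero

lemma zpow_mul_qv_nine_pow_ne_one {e : ℤ} (he : ¬ (9 : ℤ) ∣ e) (i : ℕ) :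
    qv ^ e * (qv ^ 9) ^ i ≠ 1 := by
  rw [← pow_mul, ← zpow_natCast, ← zpow_add₀ qv_ne_zero]
  refine qv_zpow_ne_one fun h => he ?_
  push_cast at h
  omega

lemma specSum_qv_pow {r n : ℕ} (hr : r = 1 ∨ r = 2 ∨ r = 4) {t : ℕ} (ht : n + r = 9 * t) :
    specSum r n (qv ^ n) = 0 := by
  have hq := qv_ne_zero
  have h9 : ∀ i : ℕ, 0 < i → (qv ^ 9) ^ i ≠ 1 := fun i hi => by
    rw [← pow_mul]; exact qv_pow_ne_one (by omega)
  have key := saalschutz_eq_zero qv_nine_ne_zero h9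
    (D := qv ^ (7 * n + 9 : ℤ)) (E := qv ^ (9 - 7 * n : ℤ))
    (zpow_mul_qv_nine_pow_ne_one (by omega)) (zpow_mul_qv_nine_pow_ne_one (by omega))
    (m := t - 1) (l := 7 * t - r) (M := n) (by omega)
  rw [← key]
  refine Finset.sum_congr rfl fun k _ => ?_
  have z : ∀ i : ℕ, qv ^ i = qv ^ (i : ℤ) := fun i => (zpow_natCast _ _).symm
  have e1 : (qv ^ n) ^ 8 * qv ^ r = qv ^ (7 * n + 9 : ℤ) * (qv ^ 9) ^ (t - 1) := by
    simp only [← pow_mul]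
    simp only [z, ← zpow_add₀ hq]
    congr 1; push_cast; omega
  have e2 : qv ^ r * (qv ^ n) ^ (-8 : ℤ) = ((qv ^ 9) ^ (t - 1 + (7 * t - r) + 1))⁻¹ := by
    simp only [← pow_mul]
    simp only [z, ← zpow_mul, ← zpow_add₀ hq, ← zpow_neg]
    congr 1; push_cast; omega
  have e3 : qv ^ (9 - 2 * r) = qv ^ (9 - 7 * n : ℤ) * (qv ^ 9) ^ (7 * t - r) := by
    simp only [← pow_mul]
    simp only [z, ← zpow_add₀ hq]
    congr 1; omega
  have e4 : (qv ^ n) ^ 7 * qv ^ 9 = qv ^ (7 * n + 9 : ℤ) := by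
    simp only [← pow_mul]
    simp only [z, ← zpow_add₀ hq]
    congr 1; push_cast; omega
  have e5 : qv ^ 9 * (qv ^ n) ^ (-7 : ℤ) = qv ^ (9 - 7 * n : ℤ) := by
    simp only [z, ← zpow_mul, ← zpow_add₀ hq]
    congr 1; push_cast; omega
  rw [e1, e2, e3, e4, e5, pow_mul]

/-! ### Specialization -/

/-- The specialization `a ↦ c`, `q ↦ q`. -/
noncomputable def spec (c : FF) : MvP →ₐ[ℚ] FF := MvPolynomial.aeval ![c, qv]

@[simp] lemma spec_X_zero (c : FF) : spec c (MvPolynomial.X 0) = c := by simp [spec]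

@[simp] lemma spec_X_one (c : FF) : spec c (MvPolynomial.X 1) = qv := by simp [spec]

/-- `x` has no pole at `a = c`, and takes the value `y` there. -/
def SpecTo (c x y : FF) : Prop :=
  ∃ N C : MvP, spec c C ≠ 0 ∧ x * algebraMap MvP FF C = algebraMap MvP FF N ∧
    y * spec c C = spec c N

namespace SpecTo

variable {c x y x' y' : FF}

lemma of_poly (c : FF) (f : MvP) : SpecTo c (algebraMap MvP FF f) (spec c f) :=
  ⟨f, 1, by simp, by simp, by simp⟩

lemma one : SpecTo c 1 1 := by simpa using of_poly c 1

lemma var_a : SpecTo c av c := by simpa [av] using of_poly c (MvPolynomial.X 0)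

lemma var_q : SpecTo c qv qv := by simpa [qv] using of_poly c (MvPolynomial.X 1)

lemma add (h : SpecTo c x y) (h' : SpecTo c x' y') : SpecTo c (x + x') (y + y') := by
  obtain ⟨N, C, hC, h1, h2⟩ := h
  obtain ⟨N', C', hC', h1', h2'⟩ := h'
  refine ⟨N * C' + N' * C, C * C', by simp [hC, hC'], ?_, ?_⟩
  · simp only [map_add, map_mul, ← h1, ← h1']; ring
  · simp only [map_add, map_mul, ← h2, ← h2']; ring

lemma sub (h : SpecTo c x y) (h' : SpecTo c x' y') : SpecTo c (x - x') (y - y') := by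
  obtain ⟨N, C, hC, h1, h2⟩ := h
  obtain ⟨N', C', hC', h1', h2'⟩ := h'
  refine ⟨N * C' - N' * C, C * C', by simp [hC, hC'], ?_, ?_⟩
  · simp only [map_sub, map_mul, ← h1, ← h1']; ring
  · simp only [map_sub, map_mul, ← h2, ← h2']; ring

lemma mul (h : SpecTo c x y) (h' : SpecTo c x' y') : SpecTo c (x * x') (y * y') := by
  obtain ⟨N, C, hC, h1, h2⟩ := h
  obtain ⟨N', C', hC', h1', h2'⟩ := h'
  refine ⟨N * N', C * C', by simp [hC, hC'], ?_, ?_⟩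
  · simp only [map_mul, ← h1, ← h1']; ring
  · simp only [map_mul, ← h2, ← h2']; ring

lemma inv (h : SpecTo c x y) (hy : y ≠ 0) : SpecTo c x⁻¹ y⁻¹ := by
  obtain ⟨N, C, hC, h1, h2⟩ := h
  have hN : spec c N ≠ 0 := h2 ▸ mul_ne_zero hy hC
  have hx : x ≠ 0 := by
    rintro rfl
    rw [zero_mul, eq_comm, map_eq_zero_iff _ (IsFractionRing.injective MvP FF)] at h1
    simp [h1] at hN
  refine ⟨C, N, hN, ?_, ?_⟩
  · rw [← h1, inv_mul_cancel_left₀ hx]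
  · rw [← h2, inv_mul_cancel_left₀ hy]

lemma div (h : SpecTo c x y) (h' : SpecTo c x' y') (hy : y' ≠ 0) :
    SpecTo c (x / x') (y / y') := by
  simpa only [div_eq_mul_inv] using h.mul (h'.inv hy)

lemma pow (h : SpecTo c x y) (k : ℕ) : SpecTo c (x ^ k) (y ^ k) := by
  induction k with
  | zero => simpa using one
  | succ k ih => simpa only [pow_succ] using ih.mul h

lemma zpow_neg (h : SpecTo c x y) (hy : y ≠ 0) (k : ℕ) :
    SpecTo c (x ^ (-k : ℤ)) (y ^ (-k : ℤ)) := by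
  simpa only [_root_.zpow_neg, zpow_natCast] using (h.pow k).inv (pow_ne_zero k hy)

lemma poch (h : SpecTo c x y) (h' : SpecTo c x' y') (k : ℕ) :
    SpecTo c (poch x x' k) (poch y y' k) := by
  induction k with
  | zero => simpa only [poch_zero] using one
  | succ k ih => simpa only [poch_succ] using ih.mul (one.sub (h.mul (h'.pow k)))

lemma sum {f g : ℕ → FF} (h : ∀ k, SpecTo c (f k) (g k)) (n : ℕ) :
    SpecTo c (∑ k ∈ Finset.range n, f k) (∑ k ∈ Finset.range n, g k) := by
  induction n with
  | zero => simpa using of_poly c 0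
  | succ n ih => simpa only [Finset.sum_range_succ] using ih.add (h n)

lemma spec_num_eq_zero (h : SpecTo c x 0) : spec c (IsFractionRing.num MvP x) = 0 := by
  obtain ⟨N, C, hC, h1, h2⟩ := h
  have hd : algebraMap MvP FF (IsFractionRing.den MvP x) ≠ 0 :=
    IsFractionRing.to_map_ne_zero_of_mem_nonZeroDivisors (IsFractionRing.den MvP x).2
  have e : IsFractionRing.num MvP x * C = N * IsFractionRing.den MvP x := by
    apply IsFractionRing.injective MvP FF
    rw [map_mul, map_mul, ← h1]
    nth_rewrite 2 [← IsFractionRing.mk'_num_den' MvP x]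
    field_simp
  have e' := congrArg (spec c) e
  rw [map_mul, map_mul, ← h2, zero_mul, zero_mul] at e'
  exact (mul_eq_zero.1 e').resolve_right hC

end SpecTo

lemma specTo_specSum {c : FF} (hc : c ≠ 0) (h1 : ∀ i : ℕ, c ^ 7 * qv ^ 9 * (qv ^ 9) ^ i ≠ 1)
    (h2 : ∀ i : ℕ, qv ^ 9 * c ^ (-7 : ℤ) * (qv ^ 9) ^ i ≠ 1) (r n : ℕ) :
    SpecTo c (specSum r n av) (specSum r n c) := by
  have ha : SpecTo c av c := SpecTo.var_a
  have hq : ∀ k, SpecTo c (qv ^ k) (qv ^ k) := SpecTo.var_q.pow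
  refine SpecTo.sum (fun k => ?_) n
  refine SpecTo.div ?_ ?_ ?_
  · exact (((((ha.pow 8).mul (hq r)).poch (hq 9) k).mul
      (((hq r).mul (ha.zpow_neg hc 8)).poch (hq 9) k)).mul ((hq _).poch (hq 9) k)).mul (hq _)
  · exact ((((ha.pow 7).mul (hq 9)).poch (hq 9) k).mul
      (((hq 9).mul (ha.zpow_neg hc 7)).poch (hq 9) k)).mul ((hq 9).poch (hq 9) k)
  · refine mul_ne_zero (mul_ne_zero (poch_ne_zero h1 k) (poch_ne_zero h2 k))
      (poch_self_ne_zero (fun i hi => ?_) k)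
    rw [← pow_mul]; exact qv_pow_ne_one (by omega)

lemma specTo_specSum_zpow {e : ℤ} (he : ¬ (9 : ℤ) ∣ 7 * e) (r n : ℕ) :
    SpecTo (qv ^ e) (specSum r n av) (specSum r n (qv ^ e)) := by
  have hq := qv_ne_zero
  refine specTo_specSum (zpow_ne_zero _ hq) ?_ ?_ r n
  · have : (qv ^ e) ^ 7 * qv ^ 9 = qv ^ (7 * e + 9) := by
      rw [zpow_add₀ hq, mul_comm 7 e, zpow_mul]; rfl
    rw [this]
    exact zpow_mul_qv_nine_pow_ne_one (by omega)
  · have : qv ^ 9 * (qv ^ e) ^ (-7 : ℤ) = qv ^ (9 + e * (-7)) := by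
      rw [zpow_add₀ hq, zpow_mul]; rfl
    rw [this]
    exact zpow_mul_qv_nine_pow_ne_one (by omega)

/-! ### Divisibility by `a q ^ i - q ^ j` -/

open MvPolynomial in
lemma exists_dvd_sub_poly_q {P : MvP} {i j : ℕ} (hP : P ∣ X 0 * X 1 ^ i - X 1 ^ j) (f : MvP) :
    ∃ (d : ℕ) (h : Polynomial ℚ), P ∣ (X 1 ^ i) ^ d * f - Polynomial.aeval (X 1 : MvP) h := by
  induction f using MvPolynomial.induction_on with
  | C s => exact ⟨0, Polynomial.C s, by simp [MvPolynomial.algebraMap_eq]⟩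
  | add f g hf hg =>
    obtain ⟨d, h, u, hu⟩ := hf
    obtain ⟨d', h', u', hu'⟩ := hg
    refine ⟨d + d', (Polynomial.X ^ i) ^ d' * h + (Polynomial.X ^ i) ^ d * h',
      (X 1 ^ i) ^ d' * u + (X 1 ^ i) ^ d * u', ?_⟩
    simp only [map_add, map_mul, map_pow, Polynomial.aeval_X]
    linear_combination (X 1 ^ i) ^ d' * hu + (X 1 ^ i) ^ d * hu'
  | mul_X f s hf =>
    obtain ⟨d, h, u, hu⟩ := hf
    obtain ⟨v, hv⟩ := hP
    match s with
    | 0 =>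
      refine ⟨d + 1, h * Polynomial.X ^ j, u * X 0 * X 1 ^ i + v * Polynomial.aeval (X 1) h, ?_⟩
      simp only [map_mul, map_pow, Polynomial.aeval_X]
      linear_combination X 0 * X 1 ^ i * hu + Polynomial.aeval (X 1 : MvP) h * hv
    | 1 =>
      refine ⟨d, h * Polynomial.X, u * X 1, ?_⟩
      simp only [map_mul, Polynomial.aeval_X]
      linear_combination X 1 * hu

lemma aeval_qv_injective : Function.Injective (Polynomial.aeval qv : Polynomial ℚ →ₐ[ℚ] FF) := by
  have h1 : AlgebraicIndependent ℚ (MvPolynomial.X : Fin 2 → MvP) :=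
    MvPolynomial.algebraicIndependent_X _ _
  have h2 : Transcendental ℚ (MvPolynomial.X 1 : MvP) := h1.transcendental 1
  have h3 : Transcendental ℚ qv :=
    (transcendental_algebraMap_iff (IsFractionRing.injective MvP FF)).2 h2
  exact transcendental_iff_injective.1 h3

open MvPolynomial in
lemma dvd_iff_spec_eq_zero {P : MvP} {i j : ℕ} (hP : P ∣ X 0 * X 1 ^ i - X 1 ^ j)
    (hPi : IsCoprime P (X 1 ^ i)) {c : FF} (hc : spec c P = 0) {f : MvP} :
    P ∣ f ↔ spec c f = 0 := by
  refine ⟨fun ⟨g, hg⟩ => by rw [hg, map_mul, hc, zero_mul], fun hf => ?_⟩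
  obtain ⟨d, h, hd⟩ := exists_dvd_sub_poly_q hP f
  have h0 : h = 0 := by
    apply aeval_qv_injective
    obtain ⟨u, hu⟩ := hd
    have := congrArg (spec c) hu
    rw [map_sub, map_mul, hf, map_mul, hc, ← Polynomial.aeval_algHom_apply, spec_X_one] at this
    simpa using this
  rw [h0, map_zero, sub_zero] at hd
  exact (hPi.pow_right).dvd_of_dvd_mul_left hd

lemma prime_of_dvd_iff_spec {P : MvP} (hP0 : P ≠ 0) {c : FF}
    (h : ∀ f, P ∣ f ↔ spec c f = 0) : Prime P := by
  refine ⟨hP0, fun hu => ?_, fun f g hfg => ?_⟩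
  · simpa using (h 1).1 hu.dvd
  · rw [h, h]
    rw [h, map_mul] at hfg
    exact mul_eq_zero.1 hfg

lemma CongrZero.of_dvd_num {A : FF} {P : MvP} (h : P ∣ IsFractionRing.num MvP A) :
    CongrZero A P := by
  obtain ⟨B, hB⟩ := h
  refine ⟨B, IsFractionRing.den MvP A, nonZeroDivisors.coe_ne_zero _, ?_, ?_⟩
  · refine (IsFractionRing.num_den_reduced MvP A).symm.of_dvd_right ⟨B, hB⟩
  · rw [← mul_div_assoc, ← map_mul, ← hB]
    exact (IsFractionRing.mk'_num_den' MvP A).symm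

theorem stmt19 (r : ℕ) (hr : r ∈ ({1, 2, 4} : Set ℕ)) (n : ℕ) (hn : 0 < n)
    (hmod : (n : ℤ) ≡ -(r : ℤ) [ZMOD (9 : ℤ)]) :
    CongrZero
      (∑ k ∈ Finset.range n,
        poch (av ^ 8 * qv ^ r) (qv ^ 9) k * poch (qv ^ r * av ^ (-8 : ℤ)) (qv ^ 9) k
            * poch (qv ^ (9 - 2 * r)) (qv ^ 9) k * qv ^ (9 * k)
          / (poch (av ^ 7 * qv ^ 9) (qv ^ 9) k * poch (qv ^ 9 * av ^ (-7 : ℤ)) (qv ^ 9) k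
              * poch (qv ^ 9) (qv ^ 9) k))
      ((1 - MvPolynomial.X 0 * MvPolynomial.X 1 ^ n)
        * (MvPolynomial.X 0 - MvPolynomial.X 1 ^ n)) := by
  have hr' : r = 1 ∨ r = 2 ∨ r = 4 := by simpa using hr
  obtain ⟨t, ht⟩ : ∃ t, n + r = 9 * t := by
    have := hmod.dvd
    exact ⟨(n + r) / 9, by omega⟩
  change CongrZero (specSum r n av) _
  have hq := qv_ne_zero
  have s1 : SpecTo (qv ^ (n : ℤ))⁻¹ (specSum r n av) 0 := by
    have := specTo_specSum_zpow (e := -n) (by omega) r n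
    rwa [zpow_neg, specSum_inv, zpow_natCast, specSum_qv_pow hr' ht, ← zpow_natCast] at this
  have s2 : SpecTo (qv ^ n) (specSum r n av) 0 := by
    have := specTo_specSum_zpow (e := n) (by omega) r n
    rwa [zpow_natCast, specSum_qv_pow hr' ht] at this
  rw [zpow_natCast] at s1
  have c1 : spec (qv ^ n)⁻¹ (1 - MvPolynomial.X 0 * MvPolynomial.X 1 ^ n) = 0 := by
    simp [hq]
  have c2 : spec (qv ^ n) (MvPolynomial.X 0 - MvPolynomial.X 1 ^ n) = 0 := by
    simp
  have c3 : spec (qv ^ n)⁻¹ (MvPolynomial.X 0 - MvPolynomial.X 1 ^ n) ≠ 0 := by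
    simp only [map_sub, map_pow, spec_X_zero, spec_X_one]
    intro h
    refine qv_pow_ne_one (i := n + n) (by omega) ?_
    rw [pow_add]
    nth_rewrite 1 [← sub_eq_zero.1 h]
    exact inv_mul_cancel₀ (pow_ne_zero _ hq)
  have d1 := fun f => dvd_iff_spec_eq_zero (i := n) (j := 0)
    (P := 1 - MvPolynomial.X 0 * MvPolynomial.X 1 ^ n) ⟨-1, by ring⟩
    ⟨1, MvPolynomial.X 0, by ring⟩ c1 (f := f)
  have d2 := fun f => dvd_iff_spec_eq_zero (i := 0) (j := n)
    (P := MvPolynomial.X 0 - MvPolynomial.X 1 ^ n) ⟨1, by ring⟩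
    (by rw [pow_zero]; exact isCoprime_one_right) c2 (f := f)
  have p1 : Prime (1 - MvPolynomial.X 0 * MvPolynomial.X 1 ^ n : MvP) := by
    refine prime_of_dvd_iff_spec (fun h => ?_) d1
    simpa using congrArg (MvPolynomial.eval (0 : Fin 2 → ℚ)) h
  refine CongrZero.of_dvd_num ?_
  obtain ⟨B, hB⟩ := (d2 _).2 s2.spec_num_eq_zero
  have hdvd := (d1 _).2 s1.spec_num_eq_zero
  rw [hB] at hdvd ⊢
  rw [mul_comm (1 - _)]
  exact mul_dvd_mul_left _ ((p1.dvd_or_dvd hdvd).resolve_left fun h => c3 ((d1 _).1 h))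
end
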